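/- In the transductive Context-FTPL setup, fix a sequence (x^1,f^1),…,(x^T,f^T) of contexts x^τ ∈ X and loss functions f^τ : {0,1}^K → ℝ, and for each t let π^t be the smallest (tie-breaking order) minimizer over π ∈ Π of Σ_{τ=1}^{t−1} f^τ(π(x^τ)) + Σ_{x ∈ X} ⟨π(x), ℓ_x⟩. Then the expected regret satisfies: E[ Σ_{t=1}^T f^t(π^t(x^t)) ] − min_{π* ∈ Π} Σ_{t=1}^T f^t(π*(x^t)) ≤ 4·ε·K·Σ_{t=1}^T ‖f^t‖_*² + (10/ε)·√(d·m)·log N, where the expectation is over the i.i.d. Laplace(ε) perturbation. (Regret bound for Context-FTPL with general losses in the transductive setting, oblivious-adversary form.) -/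

import Mathlib

open MeasureTheory Finset

/-- The i.i.d. product Laplace(ε) measure on `ι → ℝ`: density
`z ↦ ∏ i (ε/2)·exp(−ε|z i|)` with respect to Lebesgue measure. -/
noncomputable def laplacePi (ι : Type*) [Fintype ι] (ε : ℝ) :
    MeasureTheory.Measure (ι → ℝ) :=
  (MeasureTheory.volume : MeasureTheory.Measure (ι → ℝ)).withDensity
    fun z => ENNReal.ofReal (∏ i, ε / 2 * Real.exp (-ε * |z i|))

/-- `⟨a, v⟩` for `a ∈ {0,1}^K` (as a Boolean vector) and `v ∈ ℝ^K`. -/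
def dotp {K : ℕ} (a : Fin K → Bool) (v : Fin K → ℝ) : ℝ :=
  ∑ j, if a j then v j else 0

/-- `‖f‖_* = max_{a ∈ {0,1}^K} |f a|` for a loss function `f`. -/
noncomputable def dualNorm {K : ℕ} (f : (Fin K → Bool) → ℝ) : ℝ :=
  Finset.univ.sup' ⟨fun _ => false, Finset.mem_univ _⟩ fun a => |f a|

/-- The smallest (in the tie-breaking linear order) minimizer of `c` over the
finite nonempty policy set `P`. -/
noncomputable def argminTie {P : Type*} [Fintype P] [Nonempty P] [LinearOrder P]
    (c : P → ℝ) : P :=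
  haveI := Classical.decPred fun p : P => ∀ q, c p ≤ c q
  (Finset.univ.filter fun p : P => ∀ q, c p ≤ c q).min' (by
    obtain ⟨p, -, hp⟩ := Finset.exists_min_image (Finset.univ : Finset P) c
      ⟨Classical.arbitrary P, Finset.mem_univ _⟩
    exact ⟨p, Finset.mem_filter.mpr ⟨Finset.mem_univ _, fun q => hp q (Finset.mem_univ q)⟩⟩)

/-! ### The Laplace distribution -/

lemma laplace_exp_eqOn_Iic (ε s : ℝ) :
    Set.EqOn (fun t : ℝ => ε / 2 * Real.exp (-ε * |t|) * Real.exp (s * t))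
      (fun t => ε / 2 * Real.exp ((ε + s) * t)) (Set.Iic 0) := by
  intro t ht
  simp only
  rw [abs_of_nonpos ht, mul_assoc, ← Real.exp_add]
  ring_nf

lemma laplace_exp_eqOn_Ioi (ε s : ℝ) :
    Set.EqOn (fun t : ℝ => ε / 2 * Real.exp (-ε * |t|) * Real.exp (s * t))
      (fun t => ε / 2 * Real.exp ((s - ε) * t)) (Set.Ioi 0) := by
  intro t ht
  simp only
  rw [abs_of_pos ht, mul_assoc, ← Real.exp_add]
  ring_nf

lemma integrable_laplace_exp {ε s : ℝ} (hs : |s| < ε) :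
    Integrable fun t : ℝ => ε / 2 * Real.exp (-ε * |t|) * Real.exp (s * t) := by
  obtain ⟨h₁, h₂⟩ := abs_lt.mp hs
  rw [← integrableOn_univ, ← Set.Iic_union_Ioi (a := (0 : ℝ))]
  refine IntegrableOn.union ?_ ?_
  · exact (integrableOn_congr_fun (laplace_exp_eqOn_Iic ε s) measurableSet_Iic).2
      ((integrableOn_exp_mul_Iic (by linarith) 0).const_mul _)
  · exact (integrableOn_congr_fun (laplace_exp_eqOn_Ioi ε s) measurableSet_Ioi).2
      ((integrableOn_exp_mul_Ioi (by linarith) 0).const_mul _)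

/-- The moment generating function of the Laplace distribution. -/
lemma integral_laplace_exp {ε s : ℝ} (hs : |s| < ε) :
    ∫ t : ℝ, ε / 2 * Real.exp (-ε * |t|) * Real.exp (s * t) = (1 - (s / ε) ^ 2)⁻¹ := by
  obtain ⟨h₁, h₂⟩ := abs_lt.mp hs
  have hi := integrable_laplace_exp hs
  rw [← intervalIntegral.integral_Iic_add_Ioi (b := (0 : ℝ)) hi.integrableOn hi.integrableOn,
    setIntegral_congr_fun measurableSet_Iic (laplace_exp_eqOn_Iic ε s),
    setIntegral_congr_fun measurableSet_Ioi (laplace_exp_eqOn_Ioi ε s),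
    integral_const_mul, integral_const_mul, integral_exp_mul_Iic (by linarith),
    integral_exp_mul_Ioi (by linarith)]
  have e₁ : ε + s ≠ 0 := by linarith
  have e₂ : s - ε ≠ 0 := by linarith
  have e₃ : ε ≠ 0 := by linarith
  have e₄ : ε ^ 2 - s ^ 2 ≠ 0 := by
    have : ε ^ 2 - s ^ 2 = -((ε + s) * (s - ε)) := by ring
    rw [this]
    exact neg_ne_zero.mpr (mul_ne_zero e₁ e₂)
  have e₅ : 1 - (s / ε) ^ 2 = (ε ^ 2 - s ^ 2) / ε ^ 2 := by field_simp
  rw [e₅, mul_zero, mul_zero, Real.exp_zero]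
  field_simp
  ring

section LaplacePi

variable {ι : Type*} [Fintype ι] {ε : ℝ}

lemma measurable_laplacePi_density (ε : ℝ) :
    Measurable fun z : ι → ℝ => ENNReal.ofReal (∏ i, ε / 2 * Real.exp (-ε * |z i|)) := by
  fun_prop

lemma laplacePi_density_nonneg (hε : 0 < ε) (z : ι → ℝ) :
    0 ≤ ∏ i, ε / 2 * Real.exp (-ε * |z i|) :=
  Finset.prod_nonneg fun _ _ => by positivity

lemma laplacePi_density_mul_exp (s z : ι → ℝ) :
    (∏ i, ε / 2 * Real.exp (-ε * |z i|)) * Real.exp (∑ i, s i * z i) =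
      ∏ i, ε / 2 * Real.exp (-ε * |z i|) * Real.exp (s i * z i) := by
  rw [Real.exp_sum, ← Finset.prod_mul_distrib]

lemma isProbabilityMeasure_laplacePi (ι : Type*) [Fintype ι] (hε : 0 < ε) :
    IsProbabilityMeasure (laplacePi ι ε) := by
  have h₀ : |(0 : ℝ)| < ε := by simpa
  have hi := integrable_laplace_exp h₀
  have hv := integral_laplace_exp h₀
  simp only [zero_mul, Real.exp_zero, mul_one] at hi hv
  refine ⟨?_⟩
  rw [laplacePi, withDensity_apply _ MeasurableSet.univ, Measure.restrict_univ,
    ← ofReal_integral_eq_lintegral_ofReal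
      (by rw [volume_pi]; exact Integrable.fintype_prod fun _ => hi)
      (Filter.Eventually.of_forall (laplacePi_density_nonneg hε)),
    integral_fintype_prod_volume_eq_prod (fun _ : ι => fun t : ℝ => ε / 2 * Real.exp (-ε * |t|))]
  simp only [hv]
  simp

lemma integrable_exp_laplacePi (hε : 0 < ε) {s : ι → ℝ} (hs : ∀ i, |s i| < ε) :
    Integrable (fun z => Real.exp (∑ i, s i * z i)) (laplacePi ι ε) := by
  rw [laplacePi, integrable_withDensity_iff (measurable_laplacePi_density ε) (by simp)]
  simp only [ENNReal.toReal_ofReal (laplacePi_density_nonneg hε _), mul_comm (Real.exp _) (∏ i, _),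
    laplacePi_density_mul_exp]
  exact Integrable.fintype_prod fun i => integrable_laplace_exp (hs i)

lemma integral_exp_laplacePi (hε : 0 < ε) {s : ι → ℝ} (hs : ∀ i, |s i| < ε) :
    ∫ z, Real.exp (∑ i, s i * z i) ∂(laplacePi ι ε) = ∏ i, (1 - (s i / ε) ^ 2)⁻¹ := by
  rw [laplacePi,
    integral_withDensity_eq_integral_toReal_smul (measurable_laplacePi_density ε) (by simp)]
  simp only [ENNReal.toReal_ofReal (laplacePi_density_nonneg hε _), smul_eq_mul,
    laplacePi_density_mul_exp]
  rw [integral_fintype_prod_volume_eq_prod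
    (fun i => fun t : ℝ => ε / 2 * Real.exp (-ε * |t|) * Real.exp (s i * t))]
  exact Finset.prod_congr rfl fun i _ => integral_laplace_exp (hs i)

lemma inv_one_sub_le_exp_two_mul {u : ℝ} (h₀ : 0 ≤ u) (h₁ : u ≤ 1 / 2) :
    (1 - u)⁻¹ ≤ Real.exp (2 * u) := by
  rw [inv_le_iff_one_le_mul₀ (by linarith)]
  nlinarith [Real.add_one_le_exp (2 * u)]

lemma integral_exp_laplacePi_le (hε : 0 < ε) {s : ι → ℝ} (hs : ∀ i, |s i| ≤ ε / 2) :
    ∫ z, Real.exp (∑ i, s i * z i) ∂(laplacePi ι ε) ≤ Real.exp (∑ i, 2 * (s i / ε) ^ 2) := by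
  have hu : ∀ i, (s i / ε) ^ 2 ≤ 1 / 2 := fun i => by
    have : |s i / ε| ≤ 1 / 2 := by
      rw [abs_div, abs_of_pos hε, div_le_iff₀ hε]
      linarith [hs i]
    nlinarith [sq_abs (s i / ε), abs_nonneg (s i / ε)]
  rw [integral_exp_laplacePi hε fun i => (hs i).trans_lt (by linarith), Real.exp_sum]
  exact Finset.prod_le_prod (fun i _ => inv_nonneg.2 (by linarith [hu i]))
    fun i _ => inv_one_sub_le_exp_two_mul (sq_nonneg _) (hu i)

/-- Translating a set by `v` decreases its Laplace measure by a factor at most `exp (-ε‖v‖₁)`. -/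
lemma exp_mul_laplacePi_real_le (hε : 0 < ε) {A B : Set (ι → ℝ)}
    (hA : MeasurableSet A) (hB : MeasurableSet B) (v : ι → ℝ) (h : ∀ z ∈ A, z + v ∈ B) :
    Real.exp (-ε * ∑ i, |v i|) * (laplacePi ι ε).real A ≤ (laplacePi ι ε).real B := by
  have := isProbabilityMeasure_laplacePi ι hε
  suffices H : ENNReal.ofReal (Real.exp (-ε * ∑ i, |v i|)) * laplacePi ι ε A ≤ laplacePi ι ε B by
    have := ENNReal.toReal_mono (measure_ne_top _ _) H
    rwa [ENNReal.toReal_mul, ENNReal.toReal_ofReal (Real.exp_nonneg _)] at this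
  have hd := measurable_laplacePi_density (ι := ι) ε
  rw [laplacePi, withDensity_apply _ hA, withDensity_apply _ hB, ← lintegral_indicator hA,
    ← lintegral_indicator hB, ← lintegral_const_mul _ (hd.indicator hA),
    ← lintegral_add_right_eq_self (μ := (volume : Measure (ι → ℝ))) (B.indicator _) v]
  refine lintegral_mono fun z => ?_
  by_cases hz : z ∈ A
  · rw [Set.indicator_of_mem hz, Set.indicator_of_mem (h z hz),
      ← ENNReal.ofReal_mul (Real.exp_nonneg _)]
    refine ENNReal.ofReal_le_ofReal ?_
    rw [Finset.mul_sum, Real.exp_sum, ← Finset.prod_mul_distrib]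
    refine Finset.prod_le_prod (fun i _ => by positivity) fun i _ => ?_
    rw [mul_left_comm, ← Real.exp_add]
    gcongr
    rw [Pi.add_apply]
    nlinarith [abs_add_le (z i) (v i)]
  · simp [hz]

end LaplacePi

/-! ### Tie-broken minimizers -/

section ArgminTie

variable {P : Type*} [Fintype P] [Nonempty P] [LinearOrder P]

lemma argminTie_spec (c : P → ℝ) :
    (∀ q, c (argminTie c) ≤ c q) ∧ ∀ p, (∀ q, c p ≤ c q) → argminTie c ≤ p := by
  let _ := Classical.decPred fun p : P => ∀ q, c p ≤ c q
  have hmem : argminTie c ∈ Finset.univ.filter fun p : P => ∀ q, c p ≤ c q := by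
    unfold argminTie
    exact Finset.min'_mem (Finset.univ.filter fun p : P => ∀ q, c p ≤ c q) _
  refine ⟨(Finset.mem_filter.1 hmem).2, fun p hp => ?_⟩
  unfold argminTie
  exact Finset.min'_le _ _ (by simpa using hp)

lemma argminTie_le (c : P → ℝ) (q : P) : c (argminTie c) ≤ c q :=
  (argminTie_spec c).1 q

lemma argminTie_eq_iff {c : P → ℝ} {p : P} :
    argminTie c = p ↔ ∀ q, c p < c q ∨ c p = c q ∧ p ≤ q := by
  obtain ⟨hmin, hfirst⟩ := argminTie_spec c
  constructor
  · rintro rfl q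
    rcases (hmin q).lt_or_eq with hlt | heq
    · exact Or.inl hlt
    · exact Or.inr ⟨heq, hfirst q fun r => heq ▸ hmin r⟩
  · intro h
    refine le_antisymm (hfirst p fun q => (h q).elim le_of_lt fun h => h.1.le) ?_
    rcases h (argminTie c) with hlt | heq
    · exact absurd (hmin p) hlt.not_ge
    · exact heq.2

lemma argminTie_eq_of_sub_le {c c' : P → ℝ} {p : P} (h : argminTie c = p)
    (hc : ∀ q, c' p - c' q ≤ c p - c q) : argminTie c' = p := by
  refine argminTie_eq_iff.2 fun q => ?_
  rcases argminTie_eq_iff.1 h q with hlt | ⟨heq, hle⟩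
  · exact Or.inl (by linarith [hc q])
  · rcases (show c' p ≤ c' q by linarith [hc q]).lt_or_eq with h' | h'
    · exact Or.inl h'
    · exact Or.inr ⟨h', hle⟩

lemma measurableSet_argminTie_eq {Ω : Type*} [MeasurableSpace Ω] {c : Ω → P → ℝ}
    (hc : ∀ p, Measurable fun ω => c ω p) (p : P) :
    MeasurableSet {ω | argminTie (c ω) = p} := by
  simp only [argminTie_eq_iff, Set.ofPred_forall]
  refine MeasurableSet.iInter fun q => ?_
  exact (measurableSet_lt (hc p) (hc q)).union
    ((measurableSet_eq_fun (hc p) (hc q)).inter (MeasurableSet.const _))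

/-- The be-the-leader lemma. -/
lemma sum_argminTie_succ_le (F : ℕ → P → ℝ) (c : P → ℝ) (T : ℕ) (q : P) :
    (∑ t ∈ range T, F t (argminTie fun p => ∑ τ ∈ range (t + 1), F τ p + c p)) +
        c (argminTie fun p => ∑ τ ∈ range 0, F τ p + c p) ≤
      ∑ t ∈ range T, F t q + c q := by
  induction T generalizing q with
  | zero => simpa using argminTie_le (fun p => ∑ τ ∈ range 0, F τ p + c p) q
  | succ T ih =>
    have h₁ := ih (argminTie fun p => ∑ τ ∈ range (T + 1), F τ p + c p)
    have h₂ := argminTie_le (fun p => ∑ τ ∈ range (T + 1), F τ p + c p) q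
    rw [Finset.sum_range_succ]
    simp only [Finset.sum_range_succ _ T] at h₁ h₂ ⊢
    linarith

end ArgminTie

/-! ### Random variables with finitely many values -/

section FiniteValued

variable {Ω P : Type*} [MeasurableSpace Ω] {μ : Measure Ω} [IsProbabilityMeasure μ] [Fintype P]

lemma integrable_comp_of_measurableSet_fiber {g : Ω → P}
    (hg : ∀ p, MeasurableSet {ω | g ω = p}) (h : P → ℝ) : Integrable (fun ω => h (g ω)) μ := by
  let _ : MeasurableSpace P := ⊤
  have hg' : Measurable g := measurable_to_countable' fun p => hg p
  exact (Integrable.of_finite (μ := μ.map g) (f := h)).comp_measurable hg'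

lemma integral_comp_eq_sum_fiber {g : Ω → P}
    (hg : ∀ p, MeasurableSet {ω | g ω = p}) (h : P → ℝ) :
    ∫ ω, h (g ω) ∂μ = ∑ p, μ.real {ω | g ω = p} * h p := by
  let _ : MeasurableSpace P := ⊤
  have hg' : Measurable g := measurable_to_countable' fun p => hg p
  have := Measure.isProbabilityMeasure_map (μ := μ) hg'.aemeasurable
  rw [← integral_map hg'.aemeasurable (f := h) (by fun_prop), integral_fintype Integrable.of_finite]
  refine Finset.sum_congr rfl fun p _ => ?_
  rw [map_measureReal_apply hg' (MeasurableSet.singleton p), smul_eq_mul]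
  rfl

lemma integral_comp_sub_integral_comp_le {g g' : Ω → P}
    (hg : ∀ p, MeasurableSet {ω | g ω = p}) (hg' : ∀ p, MeasurableSet {ω | g' ω = p})
    {h : P → ℝ} {M δ : ℝ} (hM : ∀ p, |h p| ≤ M) (hδ : 0 ≤ δ)
    (hμ : ∀ p, (1 - δ) * μ.real {ω | g ω = p} ≤ μ.real {ω | g' ω = p}) :
    ∫ ω, h (g ω) ∂μ - ∫ ω, h (g' ω) ∂μ ≤ 2 * M * δ := by
  have h₁ : ∑ p, μ.real {ω | g ω = p} = 1 := by
    simpa using (integral_comp_eq_sum_fiber (μ := μ) hg fun _ => (1 : ℝ)).symm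
  have h₂ : ∑ p, μ.real {ω | g' ω = p} = 1 := by
    simpa using (integral_comp_eq_sum_fiber (μ := μ) hg' fun _ => (1 : ℝ)).symm
  rw [integral_comp_eq_sum_fiber hg, integral_comp_eq_sum_fiber hg']
  calc ∑ p, μ.real {ω | g ω = p} * h p - ∑ p, μ.real {ω | g' ω = p} * h p
      = ∑ p, (μ.real {ω | g ω = p} - μ.real {ω | g' ω = p}) * (h p + M) := by
        simp only [mul_add, sub_mul, Finset.sum_add_distrib, Finset.sum_sub_distrib,
          ← Finset.sum_mul, h₁, h₂]
        ring
    _ ≤ ∑ p, 2 * M * δ * μ.real {ω | g ω = p} := by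
        refine Finset.sum_le_sum fun p _ => ?_
        obtain ⟨hl, hu⟩ := abs_le.1 (hM p)
        have ha : 0 ≤ μ.real {ω | g ω = p} := measureReal_nonneg
        calc (μ.real {ω | g ω = p} - μ.real {ω | g' ω = p}) * (h p + M)
            ≤ (δ * μ.real {ω | g ω = p}) * (h p + M) :=
              mul_le_mul_of_nonneg_right (by linarith [hμ p]) (by linarith)
          _ ≤ (δ * μ.real {ω | g ω = p}) * (2 * M) :=
              mul_le_mul_of_nonneg_left (by linarith) (by positivity)
          _ = 2 * M * δ * μ.real {ω | g ω = p} := by ring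
    _ = 2 * M * δ := by rw [← Finset.mul_sum, h₁, mul_one]

end FiniteValued

/-! ### Follow the perturbed leader -/

section PerturbedLeader

variable {X P : Type*} [Fintype X] {K : ℕ}

/-- The total perturbation `∑ x, ⟨π(x), ℓ_x⟩` of the policy `p`. -/
def policyPerturbation (pol : P → X → Fin K → Bool) (z : X × Fin K → ℝ) (p : P) : ℝ :=
  ∑ xc : X, dotp (pol p xc) fun j => z (xc, j)

/-- The indicator of the coordinates selected by the policy `p`. -/
def policyIndicator (pol : P → X → Fin K → Bool) (p : P) (i : X × Fin K) : ℝ :=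
  if pol p i.1 i.2 then 1 else 0

lemma policyPerturbation_eq_sum (pol : P → X → Fin K → Bool) (z : X × Fin K → ℝ) (p : P) :
    policyPerturbation pol z p = ∑ i, policyIndicator pol p i * z i := by
  simp [policyPerturbation, dotp, policyIndicator, Fintype.sum_prod_type]

lemma measurable_policyPerturbation (pol : P → X → Fin K → Bool) (p : P) :
    Measurable fun z => policyPerturbation pol z p := by
  simp only [policyPerturbation_eq_sum]
  fun_prop

lemma sum_policyIndicator_le {pol : P → X → Fin K → Bool} {m : ℕ}
    (hsparse : ∀ p x, (Finset.univ.filter fun j => pol p x j = true).card ≤ m) (p : P) :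
    ∑ i, policyIndicator pol p i ≤ (Fintype.card X : ℝ) * m := by
  rw [Fintype.sum_prod_type]
  calc ∑ x, ∑ j, policyIndicator pol p (x, j) ≤ ∑ _x : X, (m : ℝ) := by
        refine Finset.sum_le_sum fun x _ => ?_
        simpa [policyIndicator] using hsparse p x
    _ = (Fintype.card X : ℝ) * m := by simp

lemma abs_le_dualNorm (f : (Fin K → Bool) → ℝ) (a : Fin K → Bool) : |f a| ≤ dualNorm f :=
  Finset.le_sup' (fun a => |f a|) (Finset.mem_univ a)

lemma dualNorm_nonneg (f : (Fin K → Bool) → ℝ) : 0 ≤ dualNorm f :=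
  (abs_nonneg _).trans (abs_le_dualNorm f fun _ => false)

/-- The shift of the perturbation by `2‖f‖_*` in each coordinate of the context `x`, in the
direction favouring the action `a`. -/
noncomputable def favouringShift (f : (Fin K → Bool) → ℝ) (x : X) (a : Fin K → Bool)
    (i : X × Fin K) : ℝ :=
  open Classical in if i.1 = x then (if a i.2 then -(2 * dualNorm f) else 2 * dualNorm f) else 0

lemma sum_abs_favouringShift (f : (Fin K → Bool) → ℝ) (x : X) (a : Fin K → Bool) :
    ∑ i, |favouringShift f x a i| = 2 * dualNorm f * K := by
  classical
  have h : ∀ i : X × Fin K, |favouringShift f x a i| =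
      if i.1 = x then 2 * dualNorm f else 0 := fun i => by
    have := dualNorm_nonneg f
    unfold favouringShift
    split_ifs <;> simp [abs_of_nonneg this]
  simp only [h, Fintype.sum_prod_type]
  simp [mul_comm]

lemma policyPerturbation_add (pol : P → X → Fin K → Bool) (z v : X × Fin K → ℝ) (p : P) :
    policyPerturbation pol (z + v) p = policyPerturbation pol z p + policyPerturbation pol v p := by
  simp only [policyPerturbation_eq_sum, Pi.add_apply, mul_add, Finset.sum_add_distrib]

lemma policyPerturbation_favouringShift (pol : P → X → Fin K → Bool) (f : (Fin K → Bool) → ℝ)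
    (x : X) (a : Fin K → Bool) (q : P) :
    policyPerturbation pol (favouringShift f x a) q =
      ∑ j, if pol q x j then (if a j then -(2 * dualNorm f) else 2 * dualNorm f) else 0 := by
  classical
  rw [policyPerturbation, Finset.sum_eq_single x]
  · simp [dotp, favouringShift]
  · intro y _ hy
    simp [dotp, favouringShift, hy]
  · simp

/-- After the favouring shift towards the action of `p`, adding the loss `f` never hurts `p`
relative to another policy. -/
lemma add_policyPerturbation_favouringShift_le (pol : P → X → Fin K → Bool)
    (f : (Fin K → Bool) → ℝ) (x : X) (p q : P) :
    f (pol p x) + policyPerturbation pol (favouringShift f x (pol p x)) p ≤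
      f (pol q x) + policyPerturbation pol (favouringShift f x (pol p x)) q := by
  have hM := dualNorm_nonneg f
  by_cases h : pol p x = pol q x
  · simp only [policyPerturbation_favouringShift, h, le_refl]
  · obtain ⟨j₀, hj₀⟩ := Function.ne_iff.1 h
    have hp := (abs_le.1 (abs_le_dualNorm f (pol p x))).2
    have hq := (abs_le.1 (abs_le_dualNorm f (pol q x))).1
    have key : 2 * dualNorm f ≤ policyPerturbation pol (favouringShift f x (pol p x)) q -
        policyPerturbation pol (favouringShift f x (pol p x)) p := by
      simp only [policyPerturbation_favouringShift, ← Finset.sum_sub_distrib]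
      have hnn : ∀ j ∈ (Finset.univ : Finset (Fin K)), 0 ≤
          (if pol q x j then (if pol p x j then -(2 * dualNorm f) else 2 * dualNorm f) else 0) -
          (if pol p x j then (if pol p x j then -(2 * dualNorm f) else 2 * dualNorm f) else 0) :=
        fun j _ => by split_ifs <;> linarith
      refine le_trans ?_ (Finset.single_le_sum hnn (Finset.mem_univ j₀))
      revert hj₀
      cases pol p x j₀ <;> cases pol q x j₀ <;> simp
    linarith

/-- The exponential moment of the difference of two policy perturbations. -/
lemma integral_exp_policyPerturbation_sub_le (pol : P → X → Fin K → Bool) {m : ℕ}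
    (hsparse : ∀ p x, (Finset.univ.filter fun j => pol p x j = true).card ≤ m)
    {ε l : ℝ} (hε : 0 < ε) (hl : 0 ≤ l) (hlε : l ≤ ε / 2) (p q : P) :
    Integrable (fun z => Real.exp (l * (policyPerturbation pol z q - policyPerturbation pol z p)))
        (laplacePi (X × Fin K) ε) ∧
      ∫ z, Real.exp (l * (policyPerturbation pol z q - policyPerturbation pol z p))
          ∂(laplacePi (X × Fin K) ε) ≤
        Real.exp (4 * (l / ε) ^ 2 * (Fintype.card X * m)) := by
  set s : X × Fin K → ℝ := fun i => l * (policyIndicator pol q i - policyIndicator pol p i)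
  have hz : ∀ z, l * (policyPerturbation pol z q - policyPerturbation pol z p) =
      ∑ i, s i * z i := fun z => by
    simp only [policyPerturbation_eq_sum, s, ← Finset.sum_sub_distrib, Finset.mul_sum]
    exact Finset.sum_congr rfl fun i _ => by ring
  have hs : ∀ i, |s i| ≤ ε / 2 := fun i => by
    simp only [s, policyIndicator]
    split_ifs <;> simp [abs_of_nonneg hl] <;> linarith
  have hsq : ∀ i, 2 * (s i / ε) ^ 2 ≤
      2 * (l / ε) ^ 2 * (policyIndicator pol q i + policyIndicator pol p i) := fun i => by
    have hsl : s i / ε = (l / ε) * (policyIndicator pol q i - policyIndicator pol p i) := by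
      simp only [s]
      ring
    rw [hsl, mul_pow, ← mul_assoc]
    refine mul_le_mul_of_nonneg_left ?_ (by positivity)
    simp only [policyIndicator]
    split_ifs <;> norm_num
  simp only [hz]
  refine ⟨integrable_exp_laplacePi hε fun i => (hs i).trans_lt (by linarith),
    (integral_exp_laplacePi_le hε hs).trans (Real.exp_le_exp.2 ?_)⟩
  calc ∑ i, 2 * (s i / ε) ^ 2
      ≤ ∑ i, 2 * (l / ε) ^ 2 * (policyIndicator pol q i + policyIndicator pol p i) :=
        Finset.sum_le_sum fun i _ => hsq i
    _ = 2 * (l / ε) ^ 2 * (∑ i, policyIndicator pol q i + ∑ i, policyIndicator pol p i) := by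
        rw [← Finset.mul_sum, Finset.sum_add_distrib]
    _ ≤ 2 * (l / ε) ^ 2 * (Fintype.card X * m + Fintype.card X * m) := by
        gcongr <;> exact sum_policyIndicator_le hsparse _
    _ = 4 * (l / ε) ^ 2 * (Fintype.card X * m) := by ring

variable [Fintype P] [Nonempty P] [LinearOrder P]

/-- The follow-the-perturbed-leader policy of round `t`. -/
noncomputable def perturbedLeader (pol : P → X → Fin K → Bool) (xs : ℕ → X)
    (f : ℕ → (Fin K → Bool) → ℝ) (t : ℕ) (z : X × Fin K → ℝ) : P :=
  argminTie fun p => (∑ τ ∈ range t, f τ (pol p (xs τ))) + policyPerturbation pol z p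

variable (pol : P → X → Fin K → Bool) (xs : ℕ → X) (f : ℕ → (Fin K → Bool) → ℝ)

lemma measurableSet_perturbedLeader_eq (t : ℕ) (p : P) :
    MeasurableSet {z | perturbedLeader pol xs f t z = p} :=
  measurableSet_argminTie_eq
    (fun q => measurable_const.add (measurable_policyPerturbation pol q)) p

lemma perturbedLeader_succ_add_favouringShift {t : ℕ} {z : X × Fin K → ℝ} {p : P}
    (h : perturbedLeader pol xs f t z = p) :
    perturbedLeader pol xs f (t + 1) (z + favouringShift (f t) (xs t) (pol p (xs t))) = p := by
  refine argminTie_eq_of_sub_le h fun q => ?_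
  simp only [Finset.sum_range_succ, policyPerturbation_add]
  linarith [add_policyPerturbation_favouringShift_le pol (f t) (xs t) p q]

/-- Stability of the perturbed leader between consecutive rounds. -/
lemma integral_perturbedLeader_sub_succ_le {ε : ℝ} (hε : 0 < ε) (t : ℕ) :
    (∫ z, f t (pol (perturbedLeader pol xs f t z) (xs t)) ∂(laplacePi (X × Fin K) ε)) -
        ∫ z, f t (pol (perturbedLeader pol xs f (t + 1) z) (xs t)) ∂(laplacePi (X × Fin K) ε) ≤
      4 * ε * K * dualNorm (f t) ^ 2 := by
  have := isProbabilityMeasure_laplacePi (X × Fin K) hε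
  have hM := dualNorm_nonneg (f t)
  have hmeas := measurableSet_perturbedLeader_eq pol xs f
  calc _ ≤ 2 * dualNorm (f t) * (2 * ε * K * dualNorm (f t)) := by
        refine integral_comp_sub_integral_comp_le (hmeas t) (hmeas (t + 1))
          (h := fun p => f t (pol p (xs t))) (fun p => abs_le_dualNorm _ _) (by positivity)
          fun p => ?_
        refine le_trans (mul_le_mul_of_nonneg_right ?_ measureReal_nonneg)
          (exp_mul_laplacePi_real_le hε (hmeas t p) (hmeas (t + 1) p)
            (favouringShift (f t) (xs t) (pol p (xs t)))
            fun z hz => perturbedLeader_succ_add_favouringShift pol xs f hz)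
        rw [sum_abs_favouringShift]
        refine le_trans (le_of_eq ?_) (Real.add_one_le_exp _)
        ring
    _ = 4 * ε * K * dualNorm (f t) ^ 2 := by ring

lemma sum_perturbedLeader_succ_sub_le (T : ℕ) (z : X × Fin K → ℝ) (q : P) :
    ∑ t ∈ range T, f t (pol (perturbedLeader pol xs f (t + 1) z) (xs t)) -
        ∑ t ∈ range T, f t (pol q (xs t)) ≤
      policyPerturbation pol z q - policyPerturbation pol z (perturbedLeader pol xs f 0 z) := by
  have := sum_argminTie_succ_le (fun t p => f t (pol p (xs t))) (policyPerturbation pol z) T q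
  unfold perturbedLeader
  linarith

/-- Expected regret of the (one step ahead) perturbed leader. -/
lemma integral_sum_perturbedLeader_succ_sub_le {m : ℕ}
    (hsparse : ∀ p x, (Finset.univ.filter fun j => pol p x j = true).card ≤ m)
    {ε l : ℝ} (hε : 0 < ε) (hl : 0 < l) (hlε : l ≤ ε / 2) (T : ℕ) (q : P) :
    (∫ z, ∑ t ∈ range T, f t (pol (perturbedLeader pol xs f (t + 1) z) (xs t))
        ∂(laplacePi (X × Fin K) ε)) - ∑ t ∈ range T, f t (pol q (xs t)) ≤
      (Real.log (Fintype.card P) + 4 * (l / ε) ^ 2 * (Fintype.card X * m)) / l := by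
  have := isProbabilityMeasure_laplacePi (X × Fin K) hε
  set C : ℝ := 4 * (l / ε) ^ 2 * (Fintype.card X * m)
  set A : ℝ := Real.log (Fintype.card P) + C
  set E : P → (X × Fin K → ℝ) → ℝ := fun p z =>
    Real.exp (l * (policyPerturbation pol z q - policyPerturbation pol z p))
  have hE := fun p => integral_exp_policyPerturbation_sub_le pol hsparse hε hl.le hlε p q
  have hcard : (0 : ℝ) < Fintype.card P := by exact_mod_cast Fintype.card_pos
  have hleader : Integrable (fun z => ∑ t ∈ range T,
      f t (pol (perturbedLeader pol xs f (t + 1) z) (xs t))) (laplacePi (X × Fin K) ε) :=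
    integrable_finsetSum _ fun t _ => integrable_comp_of_measurableSet_fiber
      (measurableSet_perturbedLeader_eq pol xs f (t + 1)) fun p => f t (pol p (xs t))
  have hpt : ∀ z, ∑ t ∈ range T, f t (pol (perturbedLeader pol xs f (t + 1) z) (xs t)) -
      ∑ t ∈ range T, f t (pol q (xs t)) ≤ (A - 1 + Real.exp (-A) * ∑ p, E p z) / l := fun z => by
    refine (sum_perturbedLeader_succ_sub_le pol xs f T z q).trans ?_
    rw [le_div_iff₀ hl]
    set p₀ := perturbedLeader pol xs f 0 z
    have h₁ : E p₀ z ≤ ∑ p, E p z :=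
      Finset.single_le_sum (f := fun p => E p z) (fun p _ => (Real.exp_pos _).le)
        (Finset.mem_univ p₀)
    have h₂ := Real.add_one_le_exp
      (-A + l * (policyPerturbation pol z q - policyPerturbation pol z p₀))
    rw [Real.exp_add] at h₂
    have h₃ := mul_le_mul_of_nonneg_left h₁ (Real.exp_pos (-A)).le
    simp only [E] at h₃ ⊢
    linarith
  have hsum : Integrable (fun z => ∑ p, E p z) (laplacePi (X × Fin K) ε) :=
    integrable_finsetSum _ fun p _ => (hE p).1
  have hint : ∫ z, ∑ p, E p z ∂(laplacePi (X × Fin K) ε) ≤ Real.exp A := by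
    rw [integral_finsetSum _ fun p _ => (hE p).1]
    calc _ ≤ ∑ _p : P, Real.exp C := Finset.sum_le_sum fun p _ => (hE p).2
      _ = Real.exp A := by
        rw [Real.exp_add, Real.exp_log hcard, Finset.sum_const, nsmul_eq_mul, Finset.card_univ]
  have hmono := integral_mono (hleader.sub (integrable_const _))
    (((integrable_const (A - 1)).add (hsum.const_mul (Real.exp (-A)))).div_const l) hpt
  simp only [Pi.sub_apply] at hmono
  rw [integral_sub hleader (integrable_const _), integral_div,
    integral_add' (integrable_const _) (hsum.const_mul _), integral_const_mul] at hmono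
  simp only [integral_const, probReal_univ, one_smul] at hmono
  refine hmono.trans ?_
  gcongr
  have := mul_le_mul_of_nonneg_left hint (Real.exp_pos (-A)).le
  rw [← Real.exp_add, neg_add_cancel, Real.exp_zero] at this
  linarith

end PerturbedLeader

/-- **Regret bound for Context-FTPL with general losses, transductive setting
(oblivious-adversary form).**  With `π^t` the tie-broken minimizer of the
perturbed cumulative loss of the first `t` rounds (same i.i.d. Laplace(ε)
perturbation at every round), the expected regret is at most
`4·ε·K·∑_t ‖f^t‖_*² + (10/ε)·√(dm)·log N`. -/
theorem context_ftpl_regret_transductive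
    {X P : Type*} [Fintype X] [Fintype P] [Nonempty P] [LinearOrder P]
    {K m d N : ℕ} (hK : 1 ≤ K) (hm : 1 ≤ m)
    (hd : Fintype.card X = d) (hN : Fintype.card P = N) (hN2 : 2 ≤ N)
    (pol : P → X → Fin K → Bool)
    (hsparse : ∀ p x, (Finset.univ.filter fun j => pol p x j = true).card ≤ m)
    {ε : ℝ} (hε : 0 < ε)
    (T : ℕ) (xs : ℕ → X) (f : ℕ → (Fin K → Bool) → ℝ) :
    (∫ z, (∑ t ∈ Finset.range T,
          f t (pol (argminTie fun p : P =>
            (∑ τ ∈ Finset.range t, f τ (pol p (xs τ))) +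
              ∑ xc : X, dotp (pol p xc) fun j => z (xc, j)) (xs t)))
        ∂(laplacePi (X × Fin K) ε)) -
      (Finset.univ.inf' Finset.univ_nonempty fun p : P =>
        ∑ t ∈ Finset.range T, f t (pol p (xs t))) ≤
      4 * ε * (K : ℝ) * (∑ t ∈ Finset.range T, dualNorm (f t) ^ 2) +
        10 / ε * Real.sqrt ((d : ℝ) * (m : ℝ)) * Real.log N := by
  obtain ⟨q, -, hq⟩ := Finset.exists_mem_eq_inf' (Finset.univ_nonempty (α := P)) fun p : P =>
    ∑ t ∈ Finset.range T, f t (pol p (xs t))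
  rw [hq]
  subst hd hN
  have := isProbabilityMeasure_laplacePi (X × Fin K) hε
  have hX : 0 < Fintype.card X := Fintype.card_pos_iff.2 ⟨xs 0⟩
  set D : ℝ := (Fintype.card X : ℝ) * m
  have hD : 1 ≤ D := by
    have : 1 ≤ Fintype.card X * m := Nat.mul_pos hX hm
    simp only [D]
    exact_mod_cast this
  have hS : 1 ≤ √D := Real.one_le_sqrt.2 hD
  have hSS : √D ^ 2 = D := Real.sq_sqrt (by linarith)
  have hint : ∀ t s, Integrable (fun z => f t (pol (perturbedLeader pol xs f s z) (xs t)))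
      (laplacePi (X × Fin K) ε) := fun t s =>
    integrable_comp_of_measurableSet_fiber (measurableSet_perturbedLeader_eq pol xs f s)
      fun p => f t (pol p (xs t))
  have hlead := integral_sum_perturbedLeader_succ_sub_le pol xs f hsparse hε
    (l := ε / (2 * √D)) (by positivity)
    (div_le_div_of_nonneg_left hε.le two_pos (by linarith)) T q
  have hstab := Finset.sum_le_sum fun t (_ : t ∈ range T) =>
    integral_perturbedLeader_sub_succ_le pol xs f hε t
  rw [Finset.sum_sub_distrib, ← integral_finsetSum _ fun t _ => hint t t,
    ← integral_finsetSum _ fun t _ => hint t (t + 1), ← Finset.mul_sum] at hstab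
  have hlog : Real.log 2 ≤ Real.log (Fintype.card P) :=
    Real.log_le_log two_pos (by exact_mod_cast hN2)
  have hfinal : (Real.log (Fintype.card P) + 4 * (ε / (2 * √D) / ε) ^ 2 * D) / (ε / (2 * √D)) ≤
      10 / ε * √D * Real.log (Fintype.card P) := by
    have h₁ : 4 * (ε / (2 * √D) / ε) ^ 2 * D = 1 := by
      nth_rewrite 2 [← hSS]
      field_simp
      norm_num
    have h₂ : (Real.log (Fintype.card P) + 1) / (ε / (2 * √D)) =
        √D / ε * (2 * (Real.log (Fintype.card P) + 1)) := by
      field_simp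
    rw [h₁, h₂]
    calc √D / ε * (2 * (Real.log (Fintype.card P) + 1))
        ≤ √D / ε * (10 * Real.log (Fintype.card P)) :=
          mul_le_mul_of_nonneg_left (by linarith [Real.log_two_gt_d9]) (by positivity)
      _ = 10 / ε * √D * Real.log (Fintype.card P) := by ring
  change (∫ z, (∑ t ∈ range T, f t (pol (perturbedLeader pol xs f t z) (xs t)))
    ∂(laplacePi (X × Fin K) ε)) - _ ≤ _
  linarith
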